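/- Let f : ℝ×ℝ → ℂ be continuous, 2π-periodic in its first variable and even, and suppose there exist ε > 0 and positive constants C_n (n ∈ ℤ) such that |F_0(t)| ≤ C_0 and |F_n(t)| ≤ C_n |t|^{|n|−1} for n ≠ 0, whenever |t| < ε. Then for every n ∈ ℤ, the map t ↦ ∫₀^t G_n(arctan x) · T_{|n|}(t/x) · x / √(t²−x²) dx is differentiable on (0,∞) and F_n(t) = (−1)^{|n|} · (d/dt) ∫₀^t G_n(arctan x) · T_{|n|}(t/x) · x / √(t²−x²) dx for every t > 0. -/

import Mathlib

open MeasureTheory Real Filter Set Topology ENNReal NNReal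

/-- Parametric Radon transform on the cylinder:
`Rf(θ,ρ) = (1/(2π)) ∫₀^{2π} f(s, −tan ρ · cos(θ−s)) ds`. -/
noncomputable def RT (f : ℝ → ℝ → ℂ) (θ ρ : ℝ) : ℂ :=
  (1 / (2 * π)) * ∫ s in (0:ℝ)..(2 * π), f s (-Real.tan ρ * Real.cos (θ - s))

/-- `n`-th Fourier coefficient of a function on the cylinder (in the angular variable). -/
noncomputable def Fc (f : ℝ → ℝ → ℂ) (n : ℤ) (t : ℝ) : ℂ :=
  (1 / (2 * π)) * ∫ s in (0:ℝ)..(2 * π), f s t * Complex.exp (-Complex.I * n * s)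

/-- `n`-th Fourier coefficient of `Rf` (in the variable θ). -/
noncomputable def Gc (f : ℝ → ℝ → ℂ) (n : ℤ) (ρ : ℝ) : ℂ :=
  (1 / (2 * π)) * ∫ θ in (0:ℝ)..(2 * π), RT f θ ρ * Complex.exp (-Complex.I * n * θ)

/-- The function `t ↦ ∫₀^t G_n(arctan x) · T_{|n|}(t/x) · x / √(t²−x²) dx`. -/
noncomputable def Phi (f : ℝ → ℝ → ℂ) (n : ℤ) (t : ℝ) : ℂ :=
  ∫ x in (0:ℝ)..t, Gc f n (Real.arctan x) *
    (((Polynomial.Chebyshev.T ℝ |n|).eval (t / x) * x / Real.sqrt (t ^ 2 - x ^ 2) : ℝ) : ℂ)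

/-- The singular weight of the Abel-type kernel on the interval `(r, t)`. -/
noncomputable def abelWeight (r t x : ℝ) : ℝ := x / (√(x ^ 2 - r ^ 2) * √(t ^ 2 - x ^ 2))

lemma abelWeight_nonneg {r t x : ℝ} (hx : 0 ≤ x) : 0 ≤ abelWeight r t x := by
  unfold abelWeight; positivity

lemma hasDerivAt_half_arcsin {g : ℝ → ℝ} {g' c x : ℝ} (hg : HasDerivAt g g' x) (hc : 0 < c)
    (h : 1 - g x ^ 2 = c ^ 2) : HasDerivAt (fun y ↦ arcsin (g y) / 2) (g' / (2 * c)) x := by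
  have h1 : g x ≠ -1 := fun h' ↦ by rw [h'] at h; nlinarith
  have h2 : g x ≠ 1 := fun h' ↦ by rw [h'] at h; nlinarith
  have := ((hasDerivAt_arcsin h1 h2).comp x hg).div_const 2
  rw [h, sqrt_sq hc.le] at this
  refine this.congr_deriv ?_
  field_simp

lemma hasDerivAt_abelWeight_primitive {r t x : ℝ} (hr : 0 < r) (hrx : r < x) (hxt : x < t) :
    HasDerivAt (fun y ↦ arcsin ((2 * y ^ 2 - r ^ 2 - t ^ 2) / (t ^ 2 - r ^ 2)) / 2)
      (abelWeight r t x) x := by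
  have hD : 0 < t ^ 2 - r ^ 2 := by nlinarith
  have ha : 0 < x ^ 2 - r ^ 2 := by nlinarith
  have hb : 0 < t ^ 2 - x ^ 2 := by nlinarith
  have hg : HasDerivAt (fun y : ℝ ↦ (2 * y ^ 2 - r ^ 2 - t ^ 2) / (t ^ 2 - r ^ 2))
      (4 * x / (t ^ 2 - r ^ 2)) x := by
    have := (((((hasDerivAt_id x).pow 2).const_mul 2).sub_const (r ^ 2)).sub_const
      (t ^ 2)).div_const (t ^ 2 - r ^ 2)
    refine this.congr_deriv ?_
    simp; ring
  convert hasDerivAt_half_arcsin (c := 2 * √(x ^ 2 - r ^ 2) * √(t ^ 2 - x ^ 2) / (t ^ 2 - r ^ 2))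
    hg (by positivity) ?_ using 1
  · unfold abelWeight
    have := sqrt_pos.2 ha
    have := sqrt_pos.2 hb
    field_simp
    norm_num
  · simp only [div_pow, mul_pow, sq_sqrt ha.le, sq_sqrt hb.le]
    field_simp
    ring

lemma hasDerivAt_abelWeight_mul_primitive {r t x : ℝ} (hr : 0 < r) (hrx : r < x) (hxt : x < t) :
    HasDerivAt (fun y ↦ arcsin (((r ^ 2 + t ^ 2) - 2 * r ^ 2 * t ^ 2 / y ^ 2) /
      (t ^ 2 - r ^ 2)) / 2) (r / x * (t / x) * abelWeight r t x) x := by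
  have hD : 0 < t ^ 2 - r ^ 2 := by nlinarith
  have ha : 0 < x ^ 2 - r ^ 2 := by nlinarith
  have hb : 0 < t ^ 2 - x ^ 2 := by nlinarith
  have hx : 0 < x := hr.trans hrx
  have ht : 0 < t := hx.trans hxt
  have hg : HasDerivAt (fun y : ℝ ↦ ((r ^ 2 + t ^ 2) - 2 * r ^ 2 * t ^ 2 / y ^ 2) / (t ^ 2 - r ^ 2))
      (4 * r ^ 2 * t ^ 2 / x ^ 3 / (t ^ 2 - r ^ 2)) x := by
    have := ((((hasDerivAt_pow 2 x).fun_inv (by positivity)).const_mul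
      (2 * r ^ 2 * t ^ 2)).const_sub (r ^ 2 + t ^ 2)).div_const (t ^ 2 - r ^ 2)
    simp only [← div_eq_mul_inv] at this
    refine this.congr_deriv ?_
    field_simp
    ring
  convert hasDerivAt_half_arcsin
    (c := 2 * r * t * √(x ^ 2 - r ^ 2) * √(t ^ 2 - x ^ 2) / (t ^ 2 - r ^ 2) / x ^ 2)
    hg (by have := sqrt_pos.2 ha; have := sqrt_pos.2 hb; positivity) ?_ using 1
  · unfold abelWeight
    have := sqrt_pos.2 ha
    have := sqrt_pos.2 hb
    field_simp
    norm_num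
  · simp only [div_pow, mul_pow, sq_sqrt ha.le, sq_sqrt hb.le]
    field_simp
    ring

lemma integrableOn_abelWeight {r t : ℝ} (hr : 0 < r) :
    IntegrableOn (abelWeight r t) (Ioc r t) := by
  refine intervalIntegral.integrableOn_deriv_of_nonneg (Continuous.continuousOn ?_)
    (fun x hx ↦ hasDerivAt_abelWeight_primitive hr hx.1 hx.2)
    (fun x hx ↦ abelWeight_nonneg (hr.trans hx.1).le)
  fun_prop

/-- The kernel of the iterated integral: the product of Chebyshev factors and the weight. -/
noncomputable def chebyshevKernel (n : ℤ) (r t x : ℝ) : ℝ :=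
  (Polynomial.Chebyshev.T ℝ n).eval (r / x) * (Polynomial.Chebyshev.T ℝ n).eval (t / x) *
    abelWeight r t x

lemma intervalIntegrable_chebyshevKernel (n : ℤ) {r t : ℝ} (hr : 0 < r) (hrt : r < t) :
    IntervalIntegrable (chebyshevKernel n r t) volume r t := by
  have h : IntervalIntegrable (abelWeight r t) volume r t :=
    (intervalIntegrable_iff_integrableOn_Ioc_of_le hrt.le).2 (integrableOn_abelWeight hr)
  refine h.continuousOn_mul ?_
  rw [uIcc_of_le hrt.le]
  have hdiv (c : ℝ) : ContinuousOn (fun x : ℝ ↦ c / x) (Icc r t) :=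
    continuousOn_const.div continuousOn_id fun x hx ↦ (hr.trans_le hx.1).ne'
  exact ((Polynomial.continuous _).comp_continuousOn (hdiv r)).mul
    ((Polynomial.continuous _).comp_continuousOn (hdiv t))

lemma hasDerivAt_sin_arccos_mul_sinh_arcosh (m : ℤ) {r t x : ℝ} (hr : 0 < r) (hrx : r < x)
    (hxt : x < t) :
    HasDerivAt (fun y ↦ sin (m * arccos (r / y)) * sinh (m * arcosh (t / y)))
      (m / 2 * (chebyshevKernel (m + 1) r t x - chebyshevKernel (m - 1) r t x)) x := by
  have ha : 0 < x ^ 2 - r ^ 2 := by nlinarith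
  have hb : 0 < t ^ 2 - x ^ 2 := by nlinarith
  have hx : 0 < x := hr.trans hrx
  have ht : 0 < t := hx.trans hxt
  have ha' := sqrt_pos.2 ha
  have hb' := sqrt_pos.2 hb
  have hA : √(1 - (r / x) ^ 2) = √(x ^ 2 - r ^ 2) / x := by
    rw [show 1 - (r / x) ^ 2 = (x ^ 2 - r ^ 2) / x ^ 2 by field_simp, sqrt_div ha.le,
      sqrt_sq hx.le]
  have hB : √((t / x) ^ 2 - 1) = √(t ^ 2 - x ^ 2) / x := by
    rw [show (t / x) ^ 2 - 1 = (t ^ 2 - x ^ 2) / x ^ 2 by field_simp, sqrt_div hb.le,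
      sqrt_sq hx.le]
  have h1 : r / x < 1 := (div_lt_one hx).2 hrx
  have h2 : 1 < t / x := (one_lt_div hx).2 hxt
  have h0 : 0 < r / x := by positivity
  have hdiv (c : ℝ) : HasDerivAt (fun y : ℝ ↦ c / y) (-c / x ^ 2) x := by
    have := (hasDerivAt_inv hx.ne').const_mul c
    simp only [← div_eq_mul_inv] at this
    refine this.congr_deriv ?_
    ring
  have hdα := ((hasDerivAt_arccos (by linarith) h1.ne).comp x (hdiv r)).const_mul (m : ℝ)
  have hdβ := ((hasDerivAt_arcosh h2).comp x (hdiv t)).const_mul (m : ℝ)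
  have hd := hdα.sin.mul hdβ.sinh
  have hcα : cos (arccos (r / x)) = r / x := cos_arccos (by linarith) h1.le
  have hcβ : cosh (arcosh (t / x)) = t / x := cosh_arcosh h2.le
  have hsα : sin (arccos (r / x)) = √(x ^ 2 - r ^ 2) / x := by rw [sin_arccos, hA]
  have hsβ : sinh (arcosh (t / x)) = √(t ^ 2 - x ^ 2) / x := by rw [sinh_arcosh h2.le, hB]
  have hT (k : ℤ) : chebyshevKernel k r t x =
      cos (k * arccos (r / x)) * cosh (k * arcosh (t / x)) * abelWeight r t x := by
    rw [← Polynomial.Chebyshev.T_real_cos, ← Polynomial.Chebyshev.T_real_cosh, hcα, hcβ,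
      chebyshevKernel]
  refine hd.congr_deriv ?_
  rw [hT, hT]
  push_cast
  simp only [add_mul, sub_mul, one_mul, cos_add, cos_sub, cosh_add, cosh_sub, hcα, hcβ, hsα, hsβ,
    Function.comp, hA, hB, abelWeight]
  field_simp
  ring

lemma integral_chebyshevKernel_succ_eq_pred (m : ℤ) (hm : m ≠ 0) {r t : ℝ} (hr : 0 < r)
    (hrt : r < t) :
    ∫ x in r..t, chebyshevKernel (m + 1) r t x = ∫ x in r..t, chebyshevKernel (m - 1) r t x := by
  have hi (k : ℤ) := intervalIntegrable_chebyshevKernel k hr hrt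
  have ht : 0 < t := hr.trans hrt
  have hdiv (c : ℝ) : ContinuousOn (fun x : ℝ ↦ c / x) (Icc r t) :=
    continuousOn_const.div continuousOn_id fun x hx ↦ (hr.trans_le hx.1).ne'
  have hc : ContinuousOn (fun y ↦ sin (m * arccos (r / y)) * sinh (m * arcosh (t / y)))
      (Icc r t) := by
    refine (continuous_sin.comp_continuousOn (continuousOn_const.mul
      (continuous_arccos.comp_continuousOn (hdiv r)))).mul
      (continuous_sinh.comp_continuousOn (continuousOn_const.mul
      (continuousOn_arcosh.comp (hdiv t) fun y hy ↦ ?_)))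
    exact (one_le_div (hr.trans_le hy.1)).2 hy.2
  have h := intervalIntegral.integral_eq_sub_of_hasDerivAt_of_le hrt.le hc
    (fun x hx ↦ hasDerivAt_sin_arccos_mul_sinh_arcosh m hr hx.1 hx.2)
    (((hi _).sub (hi _)).const_mul _)
  rw [intervalIntegral.integral_const_mul, intervalIntegral.integral_sub (hi _) (hi _),
    div_self hr.ne', div_self ht.ne'] at h
  have hm' : (m : ℝ) ≠ 0 := by exact_mod_cast hm
  simp at h
  rcases h with h | h
  · exact absurd h hm
  · linarith

/-- Cormack's identity: the Abel-type integral of a product of Chebyshev polynomials is constant. -/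
theorem integral_chebyshevKernel (n : ℕ) {r t : ℝ} (hr : 0 < r) (hrt : r < t) :
    ∫ x in r..t, chebyshevKernel n r t x = π / 2 := by
  have ht : 0 < t := hr.trans hrt
  have hD : 0 < t ^ 2 - r ^ 2 := by nlinarith
  induction n using Nat.twoStepInduction with
  | zero =>
    rw [intervalIntegral.integral_eq_sub_of_hasDerivAt_of_le hrt.le
      (f := fun y ↦ arcsin ((2 * y ^ 2 - r ^ 2 - t ^ 2) / (t ^ 2 - r ^ 2)) / 2)
      (Continuous.continuousOn (by fun_prop))
      (fun x hx ↦ ?_) (intervalIntegrable_chebyshevKernel _ hr hrt)]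
    · have h1 : (2 * t ^ 2 - r ^ 2 - t ^ 2) / (t ^ 2 - r ^ 2) = 1 := by field_simp; ring
      have h2 : (2 * r ^ 2 - r ^ 2 - t ^ 2) / (t ^ 2 - r ^ 2) = -1 := by field_simp; ring
      rw [h1, h2, arcsin_one, arcsin_neg_one]
      ring
    · simpa [chebyshevKernel] using hasDerivAt_abelWeight_primitive hr hx.1 hx.2
  | one =>
    rw [intervalIntegral.integral_eq_sub_of_hasDerivAt_of_le hrt.le
      (f := fun y ↦ arcsin (((r ^ 2 + t ^ 2) - 2 * r ^ 2 * t ^ 2 / y ^ 2) / (t ^ 2 - r ^ 2)) / 2)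
      ?_ (fun x hx ↦ ?_) (intervalIntegrable_chebyshevKernel _ hr hrt)]
    · have h1 : ((r ^ 2 + t ^ 2) - 2 * r ^ 2 * t ^ 2 / t ^ 2) / (t ^ 2 - r ^ 2) = 1 := by
        field_simp; ring
      have h2 : ((r ^ 2 + t ^ 2) - 2 * r ^ 2 * t ^ 2 / r ^ 2) / (t ^ 2 - r ^ 2) = -1 := by
        field_simp; ring
      rw [h1, h2, arcsin_one, arcsin_neg_one]
      ring
    · have : ContinuousOn (fun x : ℝ ↦ 2 * r ^ 2 * t ^ 2 / x ^ 2) (Icc r t) :=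
        continuousOn_const.div (by fun_prop) fun x hx ↦ (pow_pos (hr.trans_le hx.1) 2).ne'
      exact (continuous_arcsin.comp_continuousOn
        ((continuousOn_const.sub this).div_const _)).div_const _
    · simpa [chebyshevKernel] using hasDerivAt_abelWeight_mul_primitive hr hx.1 hx.2
  | more n ih _ =>
    have := integral_chebyshevKernel_succ_eq_pred (n + 1) (by positivity) hr hrt
    rw [add_sub_cancel_right, ih] at this
    rw [← this]
    push_cast
    ring_nf

lemma hasDerivAt_arcsin_div {x r : ℝ} (hr : 0 < r) (hrx : r < x) :
    HasDerivAt (fun y ↦ arcsin (y / x)) (1 / √(x ^ 2 - r ^ 2)) r := by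
  have hx : 0 < x := hr.trans hrx
  have ha : 0 < x ^ 2 - r ^ 2 := by nlinarith
  have h1 : r / x < 1 := (div_lt_one hx).2 hrx
  have h0 : 0 < r / x := by positivity
  have := (hasDerivAt_arcsin (by linarith) h1.ne).comp r ((hasDerivAt_id r).div_const x)
  refine this.congr_deriv ?_
  rw [show 1 - (r / x) ^ 2 = (x ^ 2 - r ^ 2) / x ^ 2 by field_simp, sqrt_div ha.le, sqrt_sq hx.le]
  have := sqrt_pos.2 ha
  field_simp

lemma integrableOn_inv_sqrt_sq_sub_sq {x : ℝ} :
    IntegrableOn (fun r ↦ 1 / √(x ^ 2 - r ^ 2)) (Ioo 0 x) :=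
  (intervalIntegral.integrableOn_deriv_of_nonneg
    (Continuous.continuousOn (by fun_prop : Continuous fun y ↦ arcsin (y / x)))
    (fun _ hr ↦ hasDerivAt_arcsin_div hr.1 hr.2)
    (fun _ _ ↦ by positivity)).mono_set Ioo_subset_Ioc_self

lemma integral_inv_sqrt_sq_sub_sq {x : ℝ} (hx : 0 < x) :
    ∫ r in Ioo 0 x, 1 / √(x ^ 2 - r ^ 2) = π / 2 := by
  rw [← integral_Ioc_eq_integral_Ioo, ← intervalIntegral.integral_of_le hx.le,
    intervalIntegral.integral_eq_sub_of_hasDerivAt_of_le hx.le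
    (Continuous.continuousOn (by fun_prop : Continuous fun y ↦ arcsin (y / x)))
    (fun _ hr ↦ hasDerivAt_arcsin_div hr.1 hr.2)]
  · simp [hx.ne']
  · rw [intervalIntegrable_iff_integrableOn_Ioo_of_le hx.le]
    exact integrableOn_inv_sqrt_sq_sub_sq

lemma abs_eval_T_le_two_mul_pow (k : ℕ) {y : ℝ} (hy : 1 ≤ y) :
    |(Polynomial.Chebyshev.T ℝ k).eval y| ≤ (2 * y) ^ k := by
  rw [← cosh_arcosh hy, Polynomial.Chebyshev.T_real_cosh, abs_of_pos (cosh_pos _)]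
  have h : 0 ≤ arcosh y := arcosh_nonneg hy
  calc cosh ((k : ℤ) * arcosh y) ≤ exp ((k : ℤ) * arcosh y) := by
        rw [cosh_eq]
        have : exp (-((k : ℤ) * arcosh y)) ≤ exp ((k : ℤ) * arcosh y) :=
          exp_le_exp.2 (by have : 0 ≤ ((k : ℤ) : ℝ) * arcosh y := by positivity
                           linarith)
        linarith
    _ = exp (arcosh y) ^ k := by rw [← exp_nat_mul]; simp
    _ ≤ (2 * cosh (arcosh y)) ^ k := by
        gcongr
        rw [cosh_eq]
        linarith [exp_pos (-arcosh y)]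

lemma abs_eval_T_le_one (k : ℕ) {y : ℝ} (hy : |y| ≤ 1) :
    |(Polynomial.Chebyshev.T ℝ k).eval y| ≤ 1 := by
  rw [← cos_arccos (abs_le.1 hy).1 (abs_le.1 hy).2, Polynomial.Chebyshev.T_real_cos]
  exact abs_cos_le_one _

/-- The open triangle `0 < r < x < t` in the plane of pairs `(x, r)`. -/
def openTriangle (t : ℝ) : Set (ℝ × ℝ) := {p | 0 < p.2 ∧ p.2 < p.1 ∧ p.1 < t}

lemma measurableSet_openTriangle (t : ℝ) : MeasurableSet (openTriangle t) :=
  (measurableSet_lt measurable_const measurable_snd).inter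
    ((measurableSet_lt measurable_snd measurable_fst).inter
      (measurableSet_lt measurable_fst measurable_const))

lemma indicator_openTriangle_left {E : Type*} [Zero E] {t x : ℝ} (hx : x ∈ Ioo 0 t)
    (g : ℝ × ℝ → E) :
    (fun r ↦ (openTriangle t).indicator g (x, r)) = (Ioo 0 x).indicator fun r ↦ g (x, r) := by
  ext r
  simp only [indicator, openTriangle, mem_ofPred_eq, mem_Ioo]
  congr 1
  simp [hx.2]

lemma indicator_openTriangle_left_of_notMem {E : Type*} [Zero E] {t x : ℝ} (hx : x ∉ Ioo 0 t)
    (g : ℝ × ℝ → E) :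
    (fun r ↦ (openTriangle t).indicator g (x, r)) = fun _ ↦ 0 := by
  ext r
  refine indicator_of_notMem (fun h ↦ hx ⟨h.1.trans h.2.1, h.2.2⟩) _

lemma indicator_openTriangle_right {E : Type*} [Zero E] {t r : ℝ} (hr : r ∈ Ioo 0 t)
    (g : ℝ × ℝ → E) :
    (fun x ↦ (openTriangle t).indicator g (x, r)) = (Ioo r t).indicator fun x ↦ g (x, r) := by
  ext x
  simp only [indicator, openTriangle, mem_ofPred_eq, mem_Ioo]
  congr 1
  simp [hr.1]

lemma indicator_openTriangle_right_of_notMem {E : Type*} [Zero E] {t r : ℝ} (hr : r ∉ Ioo 0 t)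
    (g : ℝ × ℝ → E) :
    (fun x ↦ (openTriangle t).indicator g (x, r)) = fun _ ↦ 0 := by
  ext x
  refine indicator_of_notMem (fun h ↦ hr ⟨h.1, h.2.1.trans h.2.2⟩) _

lemma integrable_indicator_openTriangle_inv_sqrt (t : ℝ) :
    Integrable ((openTriangle t).indicator fun p : ℝ × ℝ ↦
      1 / √(t ^ 2 - p.1 ^ 2) * (1 / √(p.1 ^ 2 - p.2 ^ 2))) (volume.prod volume) := by
  have hm : Measurable ((openTriangle t).indicator fun p : ℝ × ℝ ↦
      1 / √(t ^ 2 - p.1 ^ 2) * (1 / √(p.1 ^ 2 - p.2 ^ 2))) :=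
    Measurable.indicator (by fun_prop) (measurableSet_openTriangle t)
  refine (integrable_prod_iff hm.aestronglyMeasurable).2 ⟨.of_forall fun x ↦ ?_, ?_⟩
  · by_cases hx : x ∈ Ioo 0 t
    · rw [indicator_openTriangle_left hx, integrable_indicator_iff measurableSet_Ioo]
      exact Integrable.const_mul (integrableOn_inv_sqrt_sq_sub_sq (x := x)) (1 / √(t ^ 2 - x ^ 2))
    · rw [indicator_openTriangle_left_of_notMem hx]
      exact integrable_zero _ _ _
  · have h : (fun x ↦ ∫ r, ‖(openTriangle t).indicator (fun p : ℝ × ℝ ↦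
        1 / √(t ^ 2 - p.1 ^ 2) * (1 / √(p.1 ^ 2 - p.2 ^ 2))) (x, r)‖) =
        (Ioo 0 t).indicator fun x ↦ 1 / √(t ^ 2 - x ^ 2) * (π / 2) := by
      ext x
      simp only [norm_indicator_eq_indicator_norm]
      by_cases hx : x ∈ Ioo 0 t
      · rw [indicator_openTriangle_left hx, integral_indicator measurableSet_Ioo,
          indicator_of_mem hx, ← integral_inv_sqrt_sq_sub_sq hx.1, ← integral_const_mul]
        congr 1
        ext r
        exact norm_of_nonneg (by positivity)
      · rw [indicator_openTriangle_left_of_notMem hx, indicator_of_notMem hx, integral_zero]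
    rw [h, integrable_indicator_iff measurableSet_Ioo]
    exact integrableOn_inv_sqrt_sq_sub_sq.mul_const _

lemma norm_mul_chebyshevKernel_le {F : ℝ → ℂ} {k : ℕ} {M r x t : ℝ} (hM : 0 ≤ M)
    (hr : 0 < r) (hrx : r < x) (hxt : x < t) (hF : ‖F r‖ ≤ M * r ^ (k - 1)) :
    ‖F r * (chebyshevKernel k r t x : ℂ)‖ ≤
      M * ((2 * t) ^ k * (1 + t)) * (1 / √(t ^ 2 - x ^ 2) * (1 / √(x ^ 2 - r ^ 2))) := by
  have hx : 0 < x := hr.trans hrx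
  have ht : 0 < t := hx.trans hxt
  have h1 : |(Polynomial.Chebyshev.T ℝ k).eval (r / x)| ≤ 1 :=
    abs_eval_T_le_one k (by rw [abs_of_pos (by positivity)]; exact ((div_lt_one hx).2 hrx).le)
  have h2 := abs_eval_T_le_two_mul_pow k ((one_lt_div hx).2 hxt).le
  have h3 : r ^ (k - 1) * (2 * (t / x)) ^ k * x ≤ (2 * t) ^ k * (1 + t) := by
    rcases k with _ | k
    · simp; linarith
    · calc r ^ (k + 1 - 1) * (2 * (t / x)) ^ (k + 1) * x
          ≤ x ^ k * (2 * (t / x)) ^ (k + 1) * x := by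
            rw [Nat.add_sub_cancel]; gcongr
        _ = (2 * t) ^ (k + 1) * 1 := by
            rw [mul_one, ← mul_div_assoc, div_pow]; field_simp; ring
        _ ≤ _ := by gcongr; linarith
  rw [norm_mul, Complex.norm_real, chebyshevKernel, norm_mul, norm_mul, norm_eq_abs, norm_eq_abs,
    norm_eq_abs, abs_of_nonneg (abelWeight_nonneg hx.le), abelWeight]
  calc ‖F r‖ * (|(Polynomial.Chebyshev.T ℝ k).eval (r / x)| *
        |(Polynomial.Chebyshev.T ℝ k).eval (t / x)| * (x / (√(x ^ 2 - r ^ 2) * √(t ^ 2 - x ^ 2))))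
      ≤ M * r ^ (k - 1) * (1 * (2 * (t / x)) ^ k *
        (x / (√(x ^ 2 - r ^ 2) * √(t ^ 2 - x ^ 2)))) := by gcongr
    _ = M * (r ^ (k - 1) * (2 * (t / x)) ^ k * x) *
        (1 / √(t ^ 2 - x ^ 2) * (1 / √(x ^ 2 - r ^ 2))) := by
      rw [div_mul_div_comm, mul_comm √(x ^ 2 - r ^ 2)]; ring
    _ ≤ _ := by gcongr

lemma integrable_indicator_openTriangle_chebyshevKernel {F : ℝ → ℂ} (hFc : Continuous F) {k : ℕ}
    {M t : ℝ} (hM : 0 ≤ M) (hF : ∀ r ∈ Ioo 0 t, ‖F r‖ ≤ M * r ^ (k - 1)) :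
    Integrable ((openTriangle t).indicator fun p : ℝ × ℝ ↦
      F p.2 * (chebyshevKernel k p.2 t p.1 : ℂ)) (volume.prod volume) := by
  refine ((integrable_indicator_openTriangle_inv_sqrt t).const_mul
    (M * ((2 * t) ^ k * (1 + t)))).mono' ?_ (.of_forall fun p ↦ ?_)
  · have hT := (Polynomial.Chebyshev.T ℝ k).continuous.measurable
    have h1 : Measurable fun p : ℝ × ℝ ↦ (Polynomial.Chebyshev.T ℝ k).eval (p.2 / p.1) :=
      hT.comp (by fun_prop)
    have h2 : Measurable fun p : ℝ × ℝ ↦ (Polynomial.Chebyshev.T ℝ k).eval (t / p.1) :=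
      hT.comp (by fun_prop)
    have h3 : Measurable fun p : ℝ × ℝ ↦ F p.2 := hFc.measurable.comp measurable_snd
    refine (Measurable.indicator (h3.mul ?_) (measurableSet_openTriangle t)).aestronglyMeasurable
    unfold chebyshevKernel abelWeight
    fun_prop
  · by_cases hp : p ∈ openTriangle t
    · rw [indicator_of_mem hp, indicator_of_mem hp]
      exact norm_mul_chebyshevKernel_le hM hp.1 hp.2.1 hp.2.2
        (hF _ ⟨hp.1, hp.2.1.trans hp.2.2⟩)
    · simp [indicator_of_notMem hp]

/-- The Abel-type transform with Chebyshev factors is inverted, up to integration, by its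
companion transform. -/
theorem integral_chebyshev_abel {F : ℝ → ℂ} (hFc : Continuous F) {k : ℕ} {M t : ℝ} (ht : 0 < t)
    (hM : 0 ≤ M) (hF : ∀ r ∈ Ioo 0 t, ‖F r‖ ≤ M * r ^ (k - 1)) :
    ∫ x in Ioo 0 t, (∫ r in Ioo 0 x,
      F r * (((Polynomial.Chebyshev.T ℝ k).eval (r / x) / √(x ^ 2 - r ^ 2) : ℝ) : ℂ)) *
      (((Polynomial.Chebyshev.T ℝ k).eval (t / x) * x / √(t ^ 2 - x ^ 2) : ℝ) : ℂ) =
    π / 2 * ∫ r in (0 : ℝ)..t, F r := by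
  have key := integral_integral_swap
    (integrable_indicator_openTriangle_chebyshevKernel hFc hM hF)
    (f := fun x r ↦ (openTriangle t).indicator (fun p : ℝ × ℝ ↦
      F p.2 * (chebyshevKernel k p.2 t p.1 : ℂ)) (x, r))
  calc _ = ∫ x, ∫ r, (openTriangle t).indicator (fun p : ℝ × ℝ ↦
        F p.2 * (chebyshevKernel k p.2 t p.1 : ℂ)) (x, r) := by
        rw [← integral_indicator measurableSet_Ioo]
        congr 1
        ext x
        by_cases hx : x ∈ Ioo 0 t
        · rw [indicator_openTriangle_left hx, integral_indicator measurableSet_Ioo,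
            indicator_of_mem hx, ← integral_mul_const]
          congr 1
          ext r
          rw [mul_assoc, ← Complex.ofReal_mul, chebyshevKernel, abelWeight]
          congr 2
          rw [div_mul_div_comm, mul_div_assoc', mul_assoc]
        · rw [indicator_openTriangle_left_of_notMem hx, indicator_of_notMem hx, integral_zero]
    _ = _ := key
    _ = ∫ r, (Ioo 0 t).indicator (fun r ↦ π / 2 * F r) r := by
        congr 1
        ext r
        by_cases hr : r ∈ Ioo 0 t
        · rw [indicator_openTriangle_right hr, integral_indicator measurableSet_Ioo,
            indicator_of_mem hr]
          simp only
          rw [integral_const_mul, integral_complex_ofReal,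
            ← integral_Ioc_eq_integral_Ioo, ← intervalIntegral.integral_of_le hr.2.le,
            integral_chebyshevKernel k hr.1 hr.2]
          push_cast
          ring
        · rw [indicator_openTriangle_right_of_notMem hr, indicator_of_notMem hr, integral_zero]
    _ = _ := by
        rw [integral_indicator measurableSet_Ioo, integral_const_mul,
          ← integral_Ioc_eq_integral_Ioo, intervalIntegral.integral_of_le ht.le]

lemma continuous_Fc {f : ℝ → ℝ → ℂ} (hf : Continuous (Function.uncurry f)) (n : ℤ) :
    Continuous (Fc f n) := by
  refine continuous_const.mul
    (intervalIntegral.continuous_parametric_intervalIntegral_of_continuous' ?_ _ _)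
  have : Continuous fun p : ℝ × ℝ ↦ f p.2 p.1 := hf.comp continuous_swap
  exact this.mul (by fun_prop)

lemma exp_neg_I_mul_add_pi (n : ℤ) (s : ℂ) :
    Complex.exp (-Complex.I * n * (s + π)) = (-1) ^ n.natAbs * Complex.exp (-Complex.I * n * s) := by
  rw [mul_add, Complex.exp_add, mul_comm]
  congr 1
  rw [show -Complex.I * n * π = ((-n : ℤ) : ℂ) * (π * Complex.I) by push_cast; ring,
    Complex.exp_int_mul, Complex.exp_pi_mul_I, zpow_neg, ← inv_zpow, inv_neg_one]
  rcases Int.natAbs_eq n with h | h <;> conv_lhs => rw [h]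
  · rw [zpow_natCast]
  · rw [zpow_neg, ← inv_zpow, inv_neg_one, zpow_natCast]

lemma exp_neg_I_mul_add_two_pi (n : ℤ) (s : ℂ) :
    Complex.exp (-Complex.I * n * (s + 2 * π)) = Complex.exp (-Complex.I * n * s) := by
  rw [two_mul, ← add_assoc, exp_neg_I_mul_add_pi, exp_neg_I_mul_add_pi, ← mul_assoc,
    ← mul_pow]
  simp

lemma Fc_neg {f : ℝ → ℝ → ℂ} (hper : ∀ s t : ℝ, f (s + 2 * π) t = f s t)
    (heven : ∀ s t : ℝ, f (s + π) (-t) = f s t) (n : ℤ) (t : ℝ) :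
    Fc f n (-t) = (-1) ^ n.natAbs * Fc f n t := by
  have hp : Function.Periodic (fun s : ℝ ↦ f s t * Complex.exp (-Complex.I * n * s)) (2 * π) := by
    intro s
    simp only [hper]
    push_cast
    rw [exp_neg_I_mul_add_two_pi]
  have h1 : ∀ s : ℝ, f s (-t) * Complex.exp (-Complex.I * n * s) = (-1) ^ n.natAbs *
      (f (s + π) t * Complex.exp (-Complex.I * n * (s + π : ℝ))) := by
    intro s
    have := heven s (-t)
    rw [neg_neg] at this
    push_cast
    rw [this, exp_neg_I_mul_add_pi, mul_left_comm (f s (-t)), ← mul_assoc, ← mul_pow]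
    simp
  unfold Fc
  simp only [h1]
  rw [intervalIntegral.integral_const_mul,
    intervalIntegral.integral_comp_add_right
      (fun s : ℝ ↦ f s t * Complex.exp (-Complex.I * n * s)),
    zero_add, add_comm (2 * π) π, hp.intervalIntegral_add_eq π 0, zero_add]
  ring

lemma intervalIntegral_swap_of_continuous {g : ℝ → ℝ → ℂ} (hg : Continuous (Function.uncurry g))
    (a b c d : ℝ) :
    ∫ x in a..b, ∫ y in c..d, g x y = ∫ y in c..d, ∫ x in a..b, g x y := by
  refine intervalIntegral_intervalIntegral_swap ?_
  exact (hg.continuousOn.integrableOn_compact (isCompact_uIcc.prod isCompact_uIcc)).mono_set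
    (prod_mono uIoc_subset_uIcc uIoc_subset_uIcc)

lemma Gc_arctan {f : ℝ → ℝ → ℂ} (hf : Continuous (Function.uncurry f)) (n : ℤ) (x : ℝ) :
    Gc f n (arctan x) = 1 / (2 * π) *
      ∫ φ in (0 : ℝ)..(2 * π), Fc f n (-x * cos φ) * Complex.exp (-Complex.I * n * φ) := by
  have hf' {g h : ℝ × ℝ → ℝ} (hg : Continuous g) (hh : Continuous h) :
      Continuous fun p ↦ f (g p) (h p) := hf.comp (hg.prodMk hh)
  have hshift (s : ℝ) : ∫ θ in (0 : ℝ)..(2 * π),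
      f s (-x * cos (θ - s)) * Complex.exp (-Complex.I * n * θ) =
      ∫ φ in (0 : ℝ)..(2 * π), f s (-x * cos φ) * Complex.exp (-Complex.I * n * s) *
        Complex.exp (-Complex.I * n * φ) := by
    have hp : Function.Periodic (fun φ : ℝ ↦ f s (-x * cos φ) * Complex.exp (-Complex.I * n * s) *
        Complex.exp (-Complex.I * n * φ)) (2 * π) := by
      intro φ
      simp only [cos_add_two_pi]
      push_cast
      rw [exp_neg_I_mul_add_two_pi]
    have h := hp.intervalIntegral_add_eq (-s) 0
    rw [zero_add, neg_add_eq_sub, ← zero_sub s, ← intervalIntegral.integral_comp_sub_right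
      (fun φ : ℝ ↦ f s (-x * cos φ) * Complex.exp (-Complex.I * n * s) *
        Complex.exp (-Complex.I * n * φ))] at h
    rw [← h]
    congr 1
    ext θ
    rw [mul_assoc (f _ _), ← Complex.exp_add]
    congr 2
    push_cast
    ring
  unfold Gc RT
  simp only [tan_arctan]
  have h1 : ∀ θ : ℝ, 1 / (2 * π) * (∫ s in (0 : ℝ)..(2 * π), f s (-x * cos (θ - s))) *
      Complex.exp (-Complex.I * n * θ) = 1 / (2 * π) * ∫ s in (0 : ℝ)..(2 * π),
        f s (-x * cos (θ - s)) * Complex.exp (-Complex.I * n * θ) := fun θ ↦ by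
    rw [intervalIntegral.integral_mul_const, mul_assoc]
  have h2 : ∀ φ : ℝ, Fc f n (-x * cos φ) * Complex.exp (-Complex.I * n * φ) =
      1 / (2 * π) * ∫ s in (0 : ℝ)..(2 * π), f s (-x * cos φ) * Complex.exp (-Complex.I * n * s) *
        Complex.exp (-Complex.I * n * φ) := fun φ ↦ by
    rw [intervalIntegral.integral_mul_const, ← mul_assoc, Fc]
  simp only [h1, h2, intervalIntegral.integral_const_mul]
  congr 2
  refine (intervalIntegral_swap_of_continuous ?_ _ _ _ _).trans ?_
  · exact (hf' (by fun_prop) (by fun_prop)).mul (by fun_prop)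
  · simp only [hshift]
    refine intervalIntegral_swap_of_continuous ?_ _ _ _ _
    exact ((hf' (by fun_prop) (by fun_prop)).mul (by fun_prop)).mul (by fun_prop)

lemma Gc_arctan_eq_integral_cos {f : ℝ → ℝ → ℂ} (hf : Continuous (Function.uncurry f))
    (hper : ∀ s t : ℝ, f (s + 2 * π) t = f s t)
    (heven : ∀ s t : ℝ, f (s + π) (-t) = f s t) (n : ℤ) (x : ℝ) :
    Gc f n (arctan x) = (-1) ^ n.natAbs * (2 / π) *
      ∫ φ in (0 : ℝ)..(π / 2), Fc f n (x * cos φ) * (cos (n.natAbs * φ) : ℝ) := by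
  have hF := Fc_neg hper heven n
  have hFc := continuous_Fc hf n
  set F := Fc f n
  have hc : Continuous fun φ : ℝ ↦ F (-x * cos φ) * Complex.exp (-Complex.I * n * φ) :=
    (hFc.comp (by fun_prop)).mul (by fun_prop)
  have hc' : Continuous fun φ : ℝ ↦ F (-x * cos φ) * Complex.exp (Complex.I * n * φ) :=
    (hFc.comp (by fun_prop)).mul (by fun_prop)
  have hsq : ((-1 : ℂ) ^ n.natAbs) * (-1) ^ n.natAbs = 1 := by rw [← mul_pow]; simp
  have hpi (φ : ℝ) : F (-x * cos (φ + π)) * Complex.exp (-Complex.I * n * (φ + π : ℝ)) =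
      F (-x * cos φ) * Complex.exp (-Complex.I * n * φ) := by
    push_cast
    rw [cos_add_pi, mul_neg, hF, exp_neg_I_mul_add_pi]
    linear_combination (F (-x * cos φ) * Complex.exp (-Complex.I * n * φ)) * hsq
  have hrefl (φ : ℝ) : F (-x * cos (π - φ)) * Complex.exp (-Complex.I * n * (π - φ : ℝ)) =
      F (-x * cos φ) * Complex.exp (Complex.I * n * φ) := by
    have h := hpi (-φ)
    rw [cos_neg, neg_add_eq_sub] at h
    rw [h]
    push_cast
    congr 2
    ring
  have h1 : ∫ φ in (0 : ℝ)..(2 * π), F (-x * cos φ) * Complex.exp (-Complex.I * n * φ) =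
      2 * ∫ φ in (0 : ℝ)..π, F (-x * cos φ) * Complex.exp (-Complex.I * n * φ) := by
    have h := intervalIntegral.integral_comp_add_right (a := 0) (b := π)
      (fun φ : ℝ ↦ F (-x * cos φ) * Complex.exp (-Complex.I * n * φ)) π
    simp only [hpi] at h
    rw [zero_add, ← two_mul] at h
    rw [← intervalIntegral.integral_add_adjacent_intervals (hc.intervalIntegrable 0 π)
      (hc.intervalIntegrable π (2 * π)), ← h, two_mul]
  have h2 : ∫ φ in (0 : ℝ)..π, F (-x * cos φ) * Complex.exp (-Complex.I * n * φ) =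
      2 * ∫ φ in (0 : ℝ)..(π / 2), F (-x * cos φ) * (cos (n.natAbs * φ) : ℝ) := by
    have h := intervalIntegral.integral_comp_sub_left (a := 0) (b := π / 2)
      (fun φ : ℝ ↦ F (-x * cos φ) * Complex.exp (-Complex.I * n * φ)) π
    simp only [hrefl] at h
    rw [sub_zero, _root_.sub_half] at h
    rw [← intervalIntegral.integral_add_adjacent_intervals (hc.intervalIntegrable 0 (π / 2))
      (hc.intervalIntegrable (π / 2) π), ← h, ← intervalIntegral.integral_add
      (hc.intervalIntegrable _ _) (hc'.intervalIntegrable _ _),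
      ← intervalIntegral.integral_const_mul]
    congr 1
    ext φ
    have hcos : cos (n.natAbs * φ) = cos (n * φ) := by
      rw [Nat.cast_natAbs, Int.cast_abs]
      rcases abs_choice (n : ℝ) with h | h <;> simp [h]
    rw [hcos, ← mul_add, Complex.ofReal_cos, mul_left_comm, Complex.two_cos]
    push_cast
    congr 1
    rw [add_comm]
    congr 2 <;> ring
  rw [Gc_arctan hf, h1, h2]
  have h3 : ∀ φ : ℝ, F (-x * cos φ) = (-1) ^ n.natAbs * F (x * cos φ) := fun φ ↦ by
    rw [neg_mul, hF]
  simp only [h3, mul_assoc, intervalIntegral.integral_const_mul]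
  have : (π : ℂ) ≠ 0 := by exact_mod_cast Real.pi_ne_zero
  field_simp

lemma image_mul_cos_Ioo {x : ℝ} (hx : 0 < x) :
    (fun φ ↦ x * cos φ) '' Ioo 0 (π / 2) = Ioo 0 x := by
  ext r
  constructor
  · rintro ⟨φ, hφ, rfl⟩
    have h1 : 0 < cos φ := cos_pos_of_mem_Ioo ⟨by linarith [hφ.1, Real.pi_pos], hφ.2⟩
    have h2 : cos φ < 1 := by
      simpa using cos_lt_cos_of_nonneg_of_le_pi_div_two le_rfl hφ.2.le hφ.1
    exact ⟨by positivity, by simpa using mul_lt_mul_of_pos_left h2 hx⟩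
  · intro hr
    have h1 : r / x < 1 := (div_lt_one hx).2 hr.2
    have h0 : 0 < r / x := div_pos hr.1 hx
    refine ⟨arccos (r / x), ⟨arccos_pos.2 h1, arccos_lt_pi_div_two.2 h0⟩, ?_⟩
    simp only
    rw [cos_arccos (by linarith) h1.le]
    field_simp

lemma integral_mul_cos_eq_chebyshev (F : ℝ → ℂ) (k : ℕ) {x : ℝ} (hx : 0 < x) :
    ∫ φ in (0 : ℝ)..(π / 2), F (x * cos φ) * (cos (k * φ) : ℝ) =
    ∫ r in Ioo 0 x,
      F r * (((Polynomial.Chebyshev.T ℝ k).eval (r / x) / √(x ^ 2 - r ^ 2) : ℝ) : ℂ) := by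
  have hinj : InjOn (fun φ ↦ x * cos φ) (Ioo 0 (π / 2)) := fun a ha b hb hab ↦
    injOn_cos ⟨ha.1.le, by linarith [ha.2, Real.pi_pos]⟩ ⟨hb.1.le, by linarith [hb.2, Real.pi_pos]⟩
      (mul_left_cancel₀ hx.ne' hab)
  rw [← image_mul_cos_Ioo hx, integral_image_eq_integral_abs_deriv_smul measurableSet_Ioo
    (fun φ _ ↦ ((hasDerivAt_cos φ).const_mul x).hasDerivWithinAt) hinj,
    intervalIntegral.integral_of_le (by positivity), integral_Ioc_eq_integral_Ioo]
  refine setIntegral_congr_fun measurableSet_Ioo fun φ hφ ↦ ?_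
  have hs : 0 < sin φ := sin_pos_of_pos_of_lt_pi hφ.1 (by linarith [hφ.2, Real.pi_pos])
  have h1 : √(x ^ 2 - (x * cos φ) ^ 2) = x * sin φ := by
    rw [← sqrt_sq (by positivity : 0 ≤ x * sin φ)]
    congr 1
    linear_combination x ^ 2 * (sin_sq_add_cos_sq φ).symm
  rw [h1, mul_div_cancel_left₀ _ hx.ne', Polynomial.Chebyshev.T_real_cos, mul_neg, abs_neg,
    abs_of_pos (by positivity), Complex.real_smul, mul_left_comm, ← Complex.ofReal_mul,
    mul_div_cancel₀ _ (by positivity)]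
  simp

lemma exists_forall_norm_le_mul_pow {F : ℝ → ℂ} (hF : Continuous F) {k : ℕ} {C ε : ℝ}
    (hε : 0 < ε) (hC : 0 ≤ C) (h : ∀ t, |t| < ε → ‖F t‖ ≤ C * |t| ^ k) (t : ℝ) :
    ∃ M, 0 ≤ M ∧ ∀ r ∈ Ioo 0 t, ‖F r‖ ≤ M * r ^ k := by
  obtain ⟨B, hB⟩ := (isCompact_Icc (a := 0) (b := t)).exists_bound_of_continuousOn hF.continuousOn
  refine ⟨max C (|B| / ε ^ k), le_max_of_le_left hC, fun r hr ↦ ?_⟩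
  have hr0 := hr.1
  rcases lt_or_ge r ε with hrε | hrε
  · refine (h r (by rwa [abs_of_pos hr.1])).trans ?_
    rw [abs_of_pos hr.1]
    gcongr
    exact le_max_left _ _
  · calc ‖F r‖ ≤ |B| := (hB r ⟨hr.1.le, hr.2.le⟩).trans (le_abs_self B)
      _ = |B| / ε ^ k * ε ^ k := by field_simp
      _ ≤ max C (|B| / ε ^ k) * r ^ k := by
        gcongr
        exact le_max_right _ _

lemma Phi_eq_integral_Fc {f : ℝ → ℝ → ℂ} (hf : Continuous (Function.uncurry f))
    (hper : ∀ s t : ℝ, f (s + 2 * π) t = f s t)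
    (heven : ∀ s t : ℝ, f (s + π) (-t) = f s t) {n : ℤ} {M t : ℝ} (ht : 0 < t) (hM : 0 ≤ M)
    (hF : ∀ r ∈ Ioo 0 t, ‖Fc f n r‖ ≤ M * r ^ (n.natAbs - 1)) :
    Phi f n t = (-1) ^ n.natAbs * ∫ r in (0 : ℝ)..t, Fc f n r := by
  have key := integral_chebyshev_abel (continuous_Fc hf n) ht hM hF
  have hπ : (π : ℂ) ≠ 0 := by exact_mod_cast Real.pi_ne_zero
  rw [Phi, intervalIntegral.integral_of_le ht.le, integral_Ioc_eq_integral_Ioo]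
  trans (-1) ^ n.natAbs * (2 / π) * (π / 2 * ∫ r in (0 : ℝ)..t, Fc f n r)
  · rw [← key, ← integral_const_mul]
    refine setIntegral_congr_fun measurableSet_Ioo fun x hx ↦ ?_
    rw [Gc_arctan_eq_integral_cos hf hper heven, integral_mul_cos_eq_chebyshev _ _ hx.1,
      Int.natCast_natAbs, mul_assoc]
  · field_simp

/-- inversion formula for `R` (Fourier coefficientwise). -/
theorem statement3 (f : ℝ → ℝ → ℂ)
    (hcont : Continuous (Function.uncurry f))
    (hper : ∀ s t : ℝ, f (s + 2 * π) t = f s t)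
    (heven : ∀ s t : ℝ, f (s + π) (-t) = f s t)
    (ε : ℝ) (hε : 0 < ε) (C : ℤ → ℝ) (hC : ∀ n : ℤ, 0 < C n)
    (hF0 : ∀ t : ℝ, |t| < ε → ‖Fc f 0 t‖ ≤ C 0)
    (hFn : ∀ n : ℤ, n ≠ 0 → ∀ t : ℝ, |t| < ε → ‖Fc f n t‖ ≤ C n * |t| ^ (n.natAbs - 1)) :
    ∀ n : ℤ, ∀ t : ℝ, 0 < t →
      DifferentiableAt ℝ (Phi f n) t ∧
      Fc f n t = (-1) ^ n.natAbs * deriv (Phi f n) t := by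
  intro n t ht
  have hc := continuous_Fc hcont n
  have hbound : ∀ r, |r| < ε → ‖Fc f n r‖ ≤ C n * |r| ^ (n.natAbs - 1) := by
    intro r hr
    rcases eq_or_ne n 0 with rfl | hn
    · simpa using hF0 r hr
    · exact hFn n hn r hr
  have hsq : ((-1 : ℂ) ^ n.natAbs) * (-1) ^ n.natAbs = 1 := by rw [← mul_pow]; simp
  have hPhi : ∀ u, 0 < u → Phi f n u = (-1) ^ n.natAbs * ∫ r in (0 : ℝ)..u, Fc f n r := by
    intro u hu
    obtain ⟨M, hM, hMF⟩ := exists_forall_norm_le_mul_pow hc hε (hC n).le hbound u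
    exact Phi_eq_integral_Fc hcont hper heven hu hM hMF
  have hd : HasDerivAt (Phi f n) ((-1) ^ n.natAbs * Fc f n t) t := by
    refine ((intervalIntegral.integral_hasDerivAt_right (hc.intervalIntegrable 0 t)
      (hc.stronglyMeasurableAtFilter _ _) hc.continuousAt).const_mul _).congr_of_eventuallyEq ?_
    filter_upwards [lt_mem_nhds ht] with u hu using hPhi u hu
  refine ⟨hd.differentiableAt, ?_⟩
  rw [hd.deriv, ← mul_assoc, hsq, one_mul]
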